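/- arXiv:1204.1814 — 2 statements merged into one kernel-verified Lean document; each statement's English description precedes it below -/
import Mathlib

section
/- Let m ≥ 1, t₀ ∈ ℝ, k ∈ {1,2}, and let K, S : [t₀,∞) → M_m(ℝ) with K(t) skew-symmetric and S(t) symmetric for every t ≥ t₀. Then there exists an L_k-matrix L(t) satisfying L̇(t)·L(t)ᵀ = K(t) + S(t) for all t ≥ t₀ if and only if K and S are of class C¹ on [t₀,∞) and the following two conditions hold: (1) there exist constants μ > 0, η > 0 and a symmetric positive definite S₀ ∈ M_m(ℝ) with |2∫_{t₀}^t tr(S(ν)) dν + tr(S₀)| ≤ μ² and det(2∫_{t₀}^t S(ν) dν + S₀) ≥ η² for all t ≥ t₀; (2) sup_{t≥t₀} ‖(d^i/dt^i)K(t)‖ + sup_{t≥t₀} ‖(d^i/dt^i)S(t)‖ < ∞ for every 0 ≤ i ≤ k−1. -/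
open Matrix Set intervalIntegral

attribute [local instance] Matrix.frobeniusNormedAddCommGroup Matrix.frobeniusNormedSpace

/-- An `L_k`-matrix on `[t₀,∞)`: a `C²` matrix function with `|det L(t)| ≥ η > 0` and
`sup_{t ≥ t₀} ‖(dⁱ/dtⁱ)L(t)‖ < ∞` for every `0 ≤ i ≤ k`. -/
def IsLkMatrix (t₀ : ℝ) (k : ℕ) {m : ℕ} (L : ℝ → Matrix (Fin m) (Fin m) ℝ) : Prop :=
  ContDiffOn ℝ 2 L (Ici t₀) ∧
  (∃ η > (0:ℝ), ∀ t ∈ Ici t₀, η ≤ |(L t).det|) ∧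
  (∀ i ≤ k, ∃ M : ℝ, ∀ t ∈ Ici t₀, ‖iteratedDerivWithin i L (Ici t₀) t‖ ≤ M)

section
open MeasureTheory
open scoped BoundedContinuousFunction
variable {E : Type*} [NormedAddCommGroup E] [NormedSpace ℝ E]

theorem hasDerivWithinAt_integral_Ici [CompleteSpace E] {f : ℝ → E} {t₀ t : ℝ}
    (hf : ContinuousOn f (Ici t₀)) (ht : t ∈ Ici t₀) :
    HasDerivWithinAt (fun u => ∫ s in t₀..u, f s) (f t) (Ici t₀) t := by
  have hc : Continuous fun s => f (max t₀ s) :=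
    hf.comp_continuous (by fun_prop) fun s => mem_Ici.2 (le_max_left _ _)
  have h := (hc.integral_hasStrictDerivAt t₀ t).hasDerivAt.hasDerivWithinAt (s := Ici t₀)
  rw [max_eq_right (mem_Ici.1 ht)] at h
  refine h.congr_of_mem (fun u hu => integral_congr fun s hs => ?_) ht
  rw [uIcc_of_le (mem_Ici.1 hu)] at hs
  simp [max_eq_right hs.1]

theorem integral_Ici_clm_apply [CompleteSpace E] {F : Type*} [NormedAddCommGroup F]
    [NormedSpace ℝ F] [CompleteSpace F] (Φ : E →L[ℝ] F) {f : ℝ → E} {t₀ t : ℝ}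
    (hf : ContinuousOn f (Ici t₀)) (ht : t ∈ Ici t₀) :
    ∫ s in t₀..t, Φ (f s) = Φ (∫ s in t₀..t, f s) := by
  refine Φ.intervalIntegral_comp_comm (ContinuousOn.intervalIntegrable ?_)
  rw [uIcc_of_le (mem_Ici.1 ht)]
  exact hf.mono Icc_subset_Ici_self

/-- Bielecki-type estimate: an integral of a function dominated by `M * exp w` is controlled by the
weight `exp w` as soon as `w' = 2 * M + 1`. -/
theorem norm_exp_neg_smul_integral_le {w M : ℝ → ℝ} {D t₀ t : ℝ} (hD : 0 ≤ D) (ht : t₀ ≤ t)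
    (hM : Continuous M) (hw : ∀ s, HasDerivAt w (2 * M s + 1) s) {g : ℝ → E}
    (hg : ∀ s, ‖g s‖ ≤ M s * (Real.exp (w s) * D)) :
    ‖Real.exp (-w t) • ∫ s in t₀..t, g s‖ ≤ D / 2 := by
  have hwc : Continuous w := continuous_iff_continuousAt.2 fun s => (hw s).continuousAt
  have h1 : ‖∫ s in t₀..t, g s‖ ≤ ∫ s in t₀..t, D / 2 * (Real.exp (w s) * (2 * M s + 1)) := by
    refine norm_integral_le_of_norm_le ht (Filter.Eventually.of_forall fun s _ => ?_)
      (by apply Continuous.intervalIntegrable; fun_prop)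
    refine (hg s).trans ?_
    nlinarith [mul_nonneg (Real.exp_pos (w s)).le hD]
  rw [intervalIntegral.integral_const_mul,
    integral_eq_sub_of_hasDerivAt (fun s _ => (hw s).exp)
      (by apply Continuous.intervalIntegrable; fun_prop)] at h1
  rw [norm_smul, Real.norm_eq_abs, abs_of_pos (Real.exp_pos _)]
  have he : Real.exp (-w t) * Real.exp (w t) = 1 := by rw [← Real.exp_add]; simp
  calc _ ≤ Real.exp (-w t) * (D / 2 * (Real.exp (w t) - Real.exp (w t₀))) := by gcongr
    _ = D / 2 * (Real.exp (-w t) * Real.exp (w t) - Real.exp (-w t) * Real.exp (w t₀)) := by ring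
    _ ≤ D / 2 * 1 := by
        rw [he]
        gcongr
        linarith [mul_pos (Real.exp_pos (-w t)) (Real.exp_pos (w t₀))]
    _ = _ := mul_one _

/-- Global existence for a differential equation whose right-hand side vanishes at `0` and is
Lipschitz in the space variable, with a Lipschitz constant depending continuously on time. -/
theorem exists_forall_hasDerivAt_of_lipschitz [CompleteSpace E] {f : ℝ → E → E} {M : ℝ → ℝ}
    (t₀ : ℝ) (x₀ : E) (hM : Continuous M) (hM0 : ∀ t, 0 ≤ M t)
    (hf : Continuous f.uncurry) (hlip : ∀ t x y, ‖f t x - f t y‖ ≤ M t * ‖x - y‖)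
    (hzero : ∀ t, f t 0 = 0) :
    ∃ x : ℝ → E, x t₀ = x₀ ∧ ∀ t ∈ Ici t₀, HasDerivAt x (f t (x t)) t := by
  let w : ℝ → ℝ := fun t => ∫ s in t₀..t, (2 * M s + 1)
  have hw : ∀ t, HasDerivAt w (2 * M t + 1) t := fun t =>
    ((by fun_prop : Continuous fun s => 2 * M s + 1).integral_hasStrictDerivAt t₀ t).hasDerivAt
  have hwc : Continuous w := continuous_iff_continuousAt.2 fun s => (hw s).continuousAt
  have hw0 : ∀ t, t₀ ≤ t → 0 ≤ w t := fun t ht =>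
    integral_nonneg ht fun s _ => by linarith [hM0 s]
  let e : ℝ → ℝ := fun s => Real.exp (w s)
  have he : Continuous e := by fun_prop
  have hint : ∀ y : ℝ →ᵇ E, Continuous fun s => f s (e s • y s) := fun y =>
    hf.comp (continuous_id.prodMk (he.smul y.continuous))
  have hprim : ∀ (y : ℝ →ᵇ E) t, HasDerivAt (fun u => ∫ s in t₀..u, f s (e s • y s))
    (f t (e t • y t)) t := fun y t => ((hint y).integral_hasStrictDerivAt t₀ t).hasDerivAt
  let T₀ : (ℝ →ᵇ E) → ℝ → E := fun y t => Real.exp (-w (max t₀ t)) •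
    (x₀ + ∫ s in t₀..(max t₀ t), f s (e s • y s))
  have hT₀c : ∀ y, Continuous (T₀ y) := fun y => by
    have h : Continuous fun u => ∫ s in t₀..u, f s (e s • y s) :=
      continuous_iff_continuousAt.2 fun t => (hprim y t).continuousAt
    have h2 : Continuous fun t => max t₀ t := by fun_prop
    have h3 := h.comp h2
    simp only [Function.comp_def] at h3
    fun_prop
  have hT₀b : ∀ y t, ‖T₀ y t‖ ≤ ‖x₀‖ + ‖y‖ / 2 := fun y t => by
    simp only [T₀, smul_add]
    refine (norm_add_le _ _).trans (add_le_add ?_ ?_)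
    · rw [norm_smul, Real.norm_eq_abs, abs_of_pos (Real.exp_pos _)]
      refine mul_le_of_le_one_left (norm_nonneg _) (Real.exp_le_one_iff.2 ?_)
      linarith [hw0 _ (le_max_left t₀ t)]
    · refine norm_exp_neg_smul_integral_le (norm_nonneg y) (le_max_left _ _) hM hw fun s => ?_
      have := hlip s (e s • y s) 0
      rw [hzero, sub_zero, sub_zero, norm_smul, Real.norm_eq_abs,
        abs_of_pos (Real.exp_pos _)] at this
      refine this.trans (mul_le_mul_of_nonneg_left ?_ (hM0 s))
      gcongr
      exact y.norm_coe_le_norm s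
  let T : (ℝ →ᵇ E) → (ℝ →ᵇ E) := fun y => BoundedContinuousFunction.ofNormedAddCommGroup
    (T₀ y) (hT₀c y) _ (hT₀b y)
  have hT : ContractingWith (1 / 2) T := by
    refine ⟨by norm_num, LipschitzWith.of_dist_le_mul fun y z => ?_⟩
    rw [BoundedContinuousFunction.dist_le (by positivity)]
    intro t
    have h1 : T y t - T z t = Real.exp (-w (max t₀ t)) •
        ∫ s in t₀..(max t₀ t), (f s (e s • y s) - f s (e s • z s)) := by
      rw [intervalIntegral.integral_sub ((hint y).intervalIntegrable _ _)
        ((hint z).intervalIntegrable _ _)]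
      simp only [T, T₀, BoundedContinuousFunction.coe_ofNormedAddCommGroup]
      rw [← smul_sub]
      congr 1
      abel
    rw [dist_eq_norm, h1]
    refine (norm_exp_neg_smul_integral_le (M := M) (D := dist y z) dist_nonneg
      (le_max_left _ _) hM hw fun s => ?_).trans_eq ?_
    · refine (hlip s _ _).trans (mul_le_mul_of_nonneg_left ?_ (hM0 s))
      rw [← smul_sub, norm_smul, Real.norm_eq_abs, abs_of_pos (Real.exp_pos _), ← dist_eq_norm]
      gcongr
      exact BoundedContinuousFunction.dist_coe_le_dist s
    · push_cast
      ring
  obtain ⟨y, hy⟩ : ∃ y, T y = y := ⟨_, hT.fixedPoint_isFixedPt⟩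
  refine ⟨fun t => x₀ + ∫ s in t₀..t, f s (e s • y s), by simp, fun t ht => ?_⟩
  have hyt : e t • y t = x₀ + ∫ s in t₀..t, f s (e s • y s) := by
    have h : T₀ y t = y t := DFunLike.congr_fun hy t
    simp only [T₀, max_eq_right (mem_Ici.1 ht)] at h
    rw [← h, smul_smul, ← Real.exp_add]
    simp
  have := (hprim y t).const_add x₀
  rwa [hyt] at this

theorem iteratedDerivWithin_succ_Ici_of_hasDerivWithinAt {f f' : ℝ → E} {t₀ t : ℝ}
    (hf : ∀ t ∈ Ici t₀, HasDerivWithinAt f (f' t) (Ici t₀) t) (ht : t ∈ Ici t₀) (k : ℕ) :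
    iteratedDerivWithin (k + 1) f (Ici t₀) t = iteratedDerivWithin k f' (Ici t₀) t := by
  rw [iteratedDerivWithin_succ']
  exact iteratedDerivWithin_congr
    (fun u hu => (hf u hu).derivWithin (uniqueDiffOn_Ici t₀ u hu)) ht

/-- Composing with a continuous linear map preserves bounds on the derivatives. -/
theorem exists_bound_iteratedDerivWithin_clm_comp {F : Type*} [NormedAddCommGroup F]
    [NormedSpace ℝ F] (Φ : E →L[ℝ] F) {f : ℝ → E} {g : ℝ → F} {t₀ : ℝ} {i : ℕ}
    (hf : ContDiffOn ℝ i f (Ici t₀)) (hg : EqOn g (Φ ∘ f) (Ici t₀))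
    (hb : ∃ M : ℝ, ∀ t ∈ Ici t₀, ‖iteratedDerivWithin i f (Ici t₀) t‖ ≤ M) :
    ∃ M : ℝ, ∀ t ∈ Ici t₀, ‖iteratedDerivWithin i g (Ici t₀) t‖ ≤ M := by
  obtain ⟨M, hM⟩ := hb
  refine ⟨‖Φ‖ * M, fun t ht => ?_⟩
  rw [iteratedDerivWithin_congr hg ht, ← norm_iteratedFDerivWithin_eq_norm_iteratedDerivWithin]
  refine (Φ.norm_iteratedFDerivWithin_comp_left (hf t ht) (uniqueDiffOn_Ici t₀) ht le_rfl).trans ?_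
  rw [norm_iteratedFDerivWithin_eq_norm_iteratedDerivWithin]
  gcongr
  exact hM t ht

/-- A function with a continuous derivative on `[t₀,∞)` is of class `C¹` there. -/
theorem contDiffOn_one_Ici_of_hasDerivWithinAt {f f' : ℝ → E} {t₀ : ℝ}
    (hf : ∀ t ∈ Ici t₀, HasDerivWithinAt f (f' t) (Ici t₀) t) (hf' : ContinuousOn f' (Ici t₀)) :
    ContDiffOn ℝ 1 f (Ici t₀) := by
  rw [contDiffOn_one_iff_derivWithin (uniqueDiffOn_Ici t₀)]
  exact ⟨fun t ht => (hf t ht).differentiableWithinAt,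
    hf'.congr fun t ht => (hf t ht).derivWithin (uniqueDiffOn_Ici t₀ t ht)⟩
end

section
attribute [local instance] Matrix.frobeniusNormedRing Matrix.frobeniusNormedAlgebra
variable {n : Type*} [Fintype n] {f g : ℝ → Matrix n n ℝ} {s : Set ℝ} {t : ℝ}

theorem completeSpace_matrix : CompleteSpace (Matrix n n ℝ) := FiniteDimensional.complete ℝ _

/-- Transposition of square matrices as a continuous linear map. -/
noncomputable def Matrix.transposeL : Matrix n n ℝ →L[ℝ] Matrix n n ℝ :=
  LinearMap.toContinuousLinearMap (transposeLinearEquiv n n ℝ ℝ).toLinearMap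

theorem HasDerivWithinAt.matrix_transpose {f' : Matrix n n ℝ} (hf : HasDerivWithinAt f f' s t) :
    HasDerivWithinAt (fun t => (f t)ᵀ) f'ᵀ s t :=
  (transposeL (n := n)).hasFDerivAt.comp_hasDerivWithinAt t hf

theorem ContDiffOn.matrix_transpose {k : WithTop ℕ∞} (hf : ContDiffOn ℝ k f s) :
    ContDiffOn ℝ k (fun t => (f t)ᵀ) s :=
  (transposeL (n := n)).contDiff.comp_contDiffOn hf

/-- The continuous linear map `X ↦ (X + c Xᵀ) / 2`. -/
noncomputable def halfAddTransposeL (c : ℝ) : Matrix n n ℝ →L[ℝ] Matrix n n ℝ :=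
  (1 / 2 : ℝ) • (ContinuousLinearMap.id ℝ _ + c • transposeL)

theorem halfAddTransposeL_apply (c : ℝ) (X : Matrix n n ℝ) :
    halfAddTransposeL c X = (1 / 2 : ℝ) • (X + c • Xᵀ) := rfl

theorem ContinuousOn.matrix_mul (hf : ContinuousOn f s) (hg : ContinuousOn g s) :
    ContinuousOn (fun t => f t * g t) s :=
  hf.mul hg

theorem Matrix.frobenius_norm_mul_le_of_le {A B : Matrix n n ℝ} {a b : ℝ} (hA : ‖A‖ ≤ a)
    (hB : ‖B‖ ≤ b) : ‖A * B‖ ≤ a * b :=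
  (frobenius_norm_mul A B).trans
    (mul_le_mul hA hB (norm_nonneg _) ((norm_nonneg _).trans hA))

theorem Matrix.frobenius_norm_sq_eq_trace (A : Matrix n n ℝ) : ‖A‖ ^ 2 = (A * Aᵀ).trace := by
  rw [frobenius_norm_def, ← Real.sqrt_eq_rpow, Real.sq_sqrt (by positivity)]
  simp [trace, mul_apply, sq]

variable [DecidableEq n]

theorem HasDerivWithinAt.matrix_mul {f' g' : Matrix n n ℝ} (hf : HasDerivWithinAt f f' s t)
    (hg : HasDerivWithinAt g g' s t) :
    HasDerivWithinAt (fun t => f t * g t) (f' * g t + f t * g') s t :=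
  hf.mul hg

theorem ContDiffOn.matrix_mul {k : WithTop ℕ∞} (hf : ContDiffOn ℝ k f s)
    (hg : ContDiffOn ℝ k g s) : ContDiffOn ℝ k (fun t => f t * g t) s :=
  hf.mul hg

theorem ContDiffOn.matrix_inv {k : WithTop ℕ∞} (hf : ContDiffOn ℝ k f s)
    (hu : ∀ t ∈ s, IsUnit (f t)) : ContDiffOn ℝ k (fun t => (f t)⁻¹) s := by
  have := completeSpace_matrix (n := n)
  simp only [nonsing_inv_eq_ringInverse]
  intro t ht
  obtain ⟨u, hu⟩ := hu t ht
  have := contDiffAt_ringInverse ℝ (n := k) u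
  rw [hu] at this
  exact this.comp_contDiffWithinAt t (hf t ht)

/-- The inverse is bounded on bounded sets of matrices with determinant bounded away from `0`. -/
theorem Matrix.exists_norm_inv_le (M : ℝ) {η : ℝ} (hη : 0 < η) :
    ∃ C : ℝ, ∀ A : Matrix n n ℝ, ‖A‖ ≤ M → η ≤ |A.det| → ‖A⁻¹‖ ≤ C := by
  have : ProperSpace (Matrix n n ℝ) := FiniteDimensional.proper ℝ _
  have hadj : Continuous fun A : Matrix n n ℝ => A.adjugate := continuous_id.matrix_adjugate
  obtain ⟨C, hC⟩ := (isCompact_closedBall (0 : Matrix n n ℝ) M).exists_bound_of_continuousOn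
    hadj.continuousOn
  refine ⟨η⁻¹ * |C|, fun A hA hd => ?_⟩
  rw [inv_def, norm_smul, Ring.inverse_eq_inv', norm_inv, Real.norm_eq_abs]
  gcongr
  exact (hC A (by simpa using hA)).trans (le_abs_self C)

open scoped MatrixOrder Matrix.Norms.L2Operator in
theorem Matrix.PosDef.exists_eq_mul_transpose {A : Matrix n n ℝ} (hA : A.PosDef) :
    ∃ B : Matrix n n ℝ, A = B * Bᵀ := by
  obtain ⟨B, rfl⟩ := CStarAlgebra.nonneg_iff_eq_star_mul_self.mp hA.posSemidef.nonneg
  exact ⟨Bᵀ, by simp [star_eq_conjTranspose]⟩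
end

section
variable {n : Type*} [Fintype n] {t₀ : ℝ} {A K S : ℝ → Matrix n n ℝ}

/-- Uniqueness for the Lyapunov differential equation `X' = A X + X Aᵀ` on `[t₀,∞)`. -/
theorem eqOn_Ici_of_lyapunov {X Y : ℝ → Matrix n n ℝ} (hA : ContinuousOn A (Ici t₀))
    (hX : ∀ t ∈ Ici t₀, HasDerivWithinAt X (A t * X t + X t * (A t)ᵀ) (Ici t₀) t)
    (hY : ∀ t ∈ Ici t₀, HasDerivWithinAt Y (A t * Y t + Y t * (A t)ᵀ) (Ici t₀) t)
    (h₀ : X t₀ = Y t₀) : EqOn X Y (Ici t₀) := by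
  intro T hT
  have hsub : Icc t₀ T ⊆ Ici t₀ := Icc_subset_Ici_self
  obtain ⟨C, hC⟩ := isCompact_Icc.exists_bound_of_continuousOn (hA.mono hsub)
  have hD : ∀ t ∈ Ici t₀, HasDerivWithinAt (fun t => X t - Y t)
      (A t * (X t - Y t) + (X t - Y t) * (A t)ᵀ) (Ici t₀) t := fun t ht => by
    refine ((hX t ht).sub (hY t ht)).congr_deriv ?_
    rw [mul_sub, sub_mul]
    abel
  refine sub_eq_zero.1 (eq_zero_of_abs_deriv_le_mul_abs_self_of_eq_zero_right (K := 2 * C)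
    (fun t ht => (hD t (hsub ht)).continuousWithinAt.mono hsub)
    (fun t ht => (hD t (hsub (Ico_subset_Icc_self ht))).mono (Ici_subset_Ici.2 ht.1))
    (sub_eq_zero.2 h₀) (fun t ht => ?_) T (right_mem_Icc.2 hT))
  have h1 := frobenius_norm_mul (A t) (X t - Y t)
  have h2 := frobenius_norm_mul (X t - Y t) (A t)ᵀ
  rw [frobenius_norm_transpose] at h2
  have h3 := mul_le_mul_of_nonneg_right (hC t (Ico_subset_Icc_self ht)) (norm_nonneg (X t - Y t))
  refine (norm_add_le _ _).trans ?_
  linarith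

/-- Global existence for a linear matrix differential equation on `[t₀,∞)`. -/
theorem exists_linear_solution [DecidableEq n] (hA : ContinuousOn A (Ici t₀)) (B : Matrix n n ℝ) :
    ∃ L : ℝ → Matrix n n ℝ, L t₀ = B ∧
      ∀ t ∈ Ici t₀, HasDerivWithinAt L (A t * L t) (Ici t₀) t := by
  have := completeSpace_matrix (n := n)
  have hc : Continuous fun t => A (max t₀ t) :=
    hA.comp_continuous (by fun_prop) fun s => mem_Ici.2 (le_max_left _ _)
  obtain ⟨L, h0, hL⟩ := exists_forall_hasDerivAt_of_lipschitz (f := fun t X => A (max t₀ t) * X)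
    (M := fun t => ‖A (max t₀ t)‖) t₀ B hc.norm (fun _ => norm_nonneg _)
    ((hc.comp continuous_fst).mul continuous_snd)
    (fun t X Y => by rw [← mul_sub]; exact frobenius_norm_mul _ _) (fun t => mul_zero _)
  refine ⟨L, h0, fun t ht => ?_⟩
  have := hL t ht
  rw [max_eq_right (mem_Ici.1 ht)] at this
  exact this.hasDerivWithinAt

theorem integral_matrix_trace (hS : ContinuousOn S (Ici t₀)) {t : ℝ} (ht : t ∈ Ici t₀) :
    ∫ ν in t₀..t, (S ν).trace = (∫ ν in t₀..t, S ν).trace :=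
  have := completeSpace_matrix (n := n)
  integral_Ici_clm_apply (LinearMap.toContinuousLinearMap (traceLinearMap n ℝ ℝ)) hS ht

theorem integral_matrix_transpose (hS : ContinuousOn S (Ici t₀)) {t : ℝ} (ht : t ∈ Ici t₀) :
    ∫ ν in t₀..t, (S ν)ᵀ = (∫ ν in t₀..t, S ν)ᵀ :=
  have := completeSpace_matrix (n := n)
  integral_Ici_clm_apply transposeL hS ht

/-- The primitive `G = 2 ∫ S + S₀` factors as `L Lᵀ` along a solution of `L' = (K + S) G⁻¹ L`. -/
theorem exists_factorization [DecidableEq n] (hK : ∀ t ∈ Ici t₀, (K t)ᵀ = -K t)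
    (hS : ∀ t ∈ Ici t₀, (S t)ᵀ = S t) (hKc : ContDiffOn ℝ 1 K (Ici t₀))
    (hSc : ContDiffOn ℝ 1 S (Ici t₀)) {S₀ : Matrix n n ℝ} (hS₀ : S₀.PosDef)
    (hG : ∀ t ∈ Ici t₀, IsUnit ((2 : ℝ) • (∫ ν in t₀..t, S ν) + S₀)) :
    ∃ L L' : ℝ → Matrix n n ℝ, ContDiffOn ℝ 1 L' (Ici t₀) ∧
      (∀ t ∈ Ici t₀, HasDerivWithinAt L (L' t) (Ici t₀) t) ∧
      (∀ t ∈ Ici t₀, L' t * (L t)ᵀ = K t + S t) ∧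
      ∀ t ∈ Ici t₀, L t * (L t)ᵀ = (2 : ℝ) • (∫ ν in t₀..t, S ν) + S₀ := by
  have := completeSpace_matrix (n := n)
  set G : ℝ → Matrix n n ℝ := fun t => (2 : ℝ) • (∫ ν in t₀..t, S ν) + S₀ with hGdef
  have hGd : ∀ t ∈ Ici t₀, HasDerivWithinAt G ((2 : ℝ) • S t) (Ici t₀) t := fun t ht =>
    ((hasDerivWithinAt_integral_Ici hSc.continuousOn ht).const_smul (2 : ℝ)).add_const S₀
  have hGc : ContDiffOn ℝ 1 G (Ici t₀) :=
    contDiffOn_one_Ici_of_hasDerivWithinAt hGd (hSc.continuousOn.const_smul (2 : ℝ))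
  have hGt : ∀ t ∈ Ici t₀, (G t)ᵀ = G t := fun t ht => by
    have h0 : S₀ᵀ = S₀ := by simpa using hS₀.isHermitian.eq
    have h1 : (∫ ν in t₀..t, S ν)ᵀ = ∫ ν in t₀..t, S ν := by
      rw [← integral_matrix_transpose hSc.continuousOn ht]
      refine integral_congr fun ν hν => hS ν ?_
      rw [uIcc_of_le (mem_Ici.1 ht)] at hν
      exact hν.1
    simp [hGdef, h0, h1]
  set A : ℝ → Matrix n n ℝ := fun t => (K t + S t) * (G t)⁻¹ with hAdef
  have hAc : ContDiffOn ℝ 1 A (Ici t₀) := (hKc.add hSc).matrix_mul (hGc.matrix_inv hG)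
  have hAG : ∀ t ∈ Ici t₀, A t * G t = K t + S t := fun t ht =>
    nonsing_inv_mul_cancel_right _ _ ((isUnit_iff_isUnit_det _).1 (hG t ht))
  obtain ⟨B, hB⟩ := hS₀.exists_eq_mul_transpose
  obtain ⟨L, hL0, hL⟩ := exists_linear_solution hAc.continuousOn B
  have hLG : EqOn (fun t => L t * (L t)ᵀ) G (Ici t₀) := by
    refine eqOn_Ici_of_lyapunov hAc.continuousOn (fun t ht => ?_) (fun t ht => ?_)
      (by simp [hGdef, hL0, hB])
    · convert (hL t ht).matrix_mul (hL t ht).matrix_transpose using 1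
      simp only [transpose_mul, mul_assoc]
    · convert hGd t ht using 1
      have h := congrArg transpose (hAG t ht)
      rw [transpose_mul, transpose_add (K t), hGt t ht, hK t ht, hS t ht] at h
      rw [hAG t ht, h, two_smul]
      abel
  have hLc : ContDiffOn ℝ 1 L (Ici t₀) := contDiffOn_one_Ici_of_hasDerivWithinAt hL
    (hAc.continuousOn.matrix_mul fun t ht => (hL t ht).continuousWithinAt)
  exact ⟨L, fun t => A t * L t, hAc.matrix_mul hLc, hL,
    fun t ht => by rw [mul_assoc, ← hAG t ht]; exact congrArg (A t * ·) (hLG ht), hLG⟩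
end

section
variable {n : Type*} [Fintype n] [DecidableEq n] {t₀ : ℝ}

/-- Bounds on `P = L' Lᵀ` and its derivative in terms of bounds on the derivatives of `L`. -/
theorem exists_bound_iteratedDerivWithin_mul_transpose {L L' P : ℝ → Matrix n n ℝ} {k : ℕ}
    (hk : k ≤ 2) (hL'c : ContDiffOn ℝ 1 L' (Ici t₀))
    (hL : ∀ t ∈ Ici t₀, HasDerivWithinAt L (L' t) (Ici t₀) t)
    (hP : P = fun t => L' t * (L t)ᵀ)
    (hb : ∀ i ≤ k, ∃ M : ℝ, ∀ t ∈ Ici t₀, ‖iteratedDerivWithin i L (Ici t₀) t‖ ≤ M) :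
    ∀ i < k, ∃ M : ℝ, ∀ t ∈ Ici t₀, ‖iteratedDerivWithin i P (Ici t₀) t‖ ≤ M := by
  intro i hi
  have hL2 : ∀ t ∈ Ici t₀, HasDerivWithinAt L' (derivWithin L' (Ici t₀) t) (Ici t₀) t :=
    fun t ht => (hL'c.differentiableOn (by norm_num) t ht).hasDerivWithinAt
  obtain ⟨M₀, h₀⟩ := hb 0 (by omega)
  obtain ⟨M₁, hM₁⟩ := hb 1 (by omega)
  simp only [iteratedDerivWithin_zero] at h₀
  have h₁ : ∀ t ∈ Ici t₀, ‖L' t‖ ≤ M₁ := fun t ht => by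
    have h := hM₁ t ht
    rwa [iteratedDerivWithin_succ_Ici_of_hasDerivWithinAt hL ht, iteratedDerivWithin_zero] at h
  have h₀' : ∀ t ∈ Ici t₀, ‖(L t)ᵀ‖ ≤ M₀ := fun t ht => by
    rw [frobenius_norm_transpose]; exact h₀ t ht
  have h₁' : ∀ t ∈ Ici t₀, ‖(L' t)ᵀ‖ ≤ M₁ := fun t ht => by
    rw [frobenius_norm_transpose]; exact h₁ t ht
  obtain rfl | rfl : i = 0 ∨ i = 1 := by omega
  · simp only [iteratedDerivWithin_zero, hP]
    exact ⟨M₁ * M₀, fun t ht => frobenius_norm_mul_le_of_le (h₁ t ht) (h₀' t ht)⟩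
  · obtain ⟨M₂, h₂⟩ := hb 2 (by omega)
    refine ⟨M₂ * M₀ + M₁ * M₁, fun t ht => ?_⟩
    have h := h₂ t ht
    rw [iteratedDerivWithin_succ_Ici_of_hasDerivWithinAt hL ht,
      iteratedDerivWithin_succ_Ici_of_hasDerivWithinAt hL2 ht, iteratedDerivWithin_zero] at h
    rw [hP, iteratedDerivWithin_succ_Ici_of_hasDerivWithinAt
      (fun t ht => (hL2 t ht).matrix_mul (hL t ht).matrix_transpose) ht, iteratedDerivWithin_zero]
    exact norm_add_le_of_le (frobenius_norm_mul_le_of_le h (h₀' t ht))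
      (frobenius_norm_mul_le_of_le (h₁ t ht) (h₁' t ht))

/-- Bounds on the derivatives of `L` in terms of bounds on `P = L' Lᵀ` and its derivative. -/
theorem exists_bound_iteratedDerivWithin_of_mul_transpose {L L' P : ℝ → Matrix n n ℝ} {k : ℕ}
    (hk : k ≤ 2) (hL'c : ContDiffOn ℝ 1 L' (Ici t₀))
    (hL : ∀ t ∈ Ici t₀, HasDerivWithinAt L (L' t) (Ici t₀) t)
    (hP : ∀ t ∈ Ici t₀, L' t * (L t)ᵀ = P t) {μ η : ℝ} (hη : 0 < η)
    (hμ : ∀ t ∈ Ici t₀, ‖L t‖ ≤ μ) (hdet : ∀ t ∈ Ici t₀, η ≤ |(L t).det|)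
    (hb : ∀ i < k, ∃ M : ℝ, ∀ t ∈ Ici t₀, ‖iteratedDerivWithin i P (Ici t₀) t‖ ≤ M) :
    ∀ i ≤ k, ∃ M : ℝ, ∀ t ∈ Ici t₀, ‖iteratedDerivWithin i L (Ici t₀) t‖ ≤ M := by
  intro i hi
  have hL2 : ∀ t ∈ Ici t₀, HasDerivWithinAt L' (derivWithin L' (Ici t₀) t) (Ici t₀) t :=
    fun t ht => (hL'c.differentiableOn (by norm_num) t ht).hasDerivWithinAt
  obtain ⟨C, hC⟩ := exists_norm_inv_le (n := n) μ hη
  have hinv : ∀ t ∈ Ici t₀, ‖((L t)ᵀ)⁻¹‖ ≤ C := fun t ht =>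
    hC _ (by rw [frobenius_norm_transpose]; exact hμ t ht) (by rw [det_transpose]; exact hdet t ht)
  have hcancel : ∀ t ∈ Ici t₀, ∀ X : Matrix n n ℝ, X = X * (L t)ᵀ * ((L t)ᵀ)⁻¹ := fun t ht X => by
    refine (mul_nonsing_inv_cancel_right _ _ ?_).symm
    rw [det_transpose]
    exact (abs_pos.1 (hη.trans_le (hdet t ht))).isUnit
  obtain rfl | hi0 := Nat.eq_zero_or_pos i
  · exact ⟨μ, by simpa using hμ⟩
  obtain ⟨M₀, h₀⟩ := hb 0 (by omega)
  simp only [iteratedDerivWithin_zero] at h₀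
  have h₁ : ∀ t ∈ Ici t₀, ‖L' t‖ ≤ M₀ * C := fun t ht => by
    rw [hcancel t ht (L' t), hP t ht]
    exact frobenius_norm_mul_le_of_le (h₀ t ht) (hinv t ht)
  have h₁' : ∀ t ∈ Ici t₀, ‖(L' t)ᵀ‖ ≤ M₀ * C := fun t ht => by
    rw [frobenius_norm_transpose]; exact h₁ t ht
  obtain rfl | rfl : i = 1 ∨ i = 2 := by omega
  · refine ⟨M₀ * C, fun t ht => ?_⟩
    rw [iteratedDerivWithin_succ_Ici_of_hasDerivWithinAt hL ht, iteratedDerivWithin_zero]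
    exact h₁ t ht
  · obtain ⟨M₁, hM₁⟩ := hb 1 (by omega)
    refine ⟨(M₁ + M₀ * C * (M₀ * C)) * C, fun t ht => ?_⟩
    have h := hM₁ t ht
    rw [← iteratedDerivWithin_congr hP ht, iteratedDerivWithin_succ_Ici_of_hasDerivWithinAt
      (fun t ht => (hL2 t ht).matrix_mul (hL t ht).matrix_transpose) ht,
      iteratedDerivWithin_zero] at h
    rw [iteratedDerivWithin_succ_Ici_of_hasDerivWithinAt hL ht,
      iteratedDerivWithin_succ_Ici_of_hasDerivWithinAt hL2 ht, iteratedDerivWithin_zero,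
      hcancel t ht (derivWithin L' (Ici t₀) t),
      ← add_sub_cancel_right (derivWithin L' (Ici t₀) t * (L t)ᵀ) (L' t * (L' t)ᵀ)]
    exact frobenius_norm_mul_le_of_le (norm_sub_le_of_le h
      (frobenius_norm_mul_le_of_le (h₁ t ht) (h₁' t ht))) (hinv t ht)

/-- If `P + Pᵀ = 2 S` with `P = L' Lᵀ`, then `2 ∫ S` is the increment of `L Lᵀ`. -/
theorem two_smul_integral_add_eq {L L' S : ℝ → Matrix n n ℝ} (hSc : ContinuousOn S (Ici t₀))
    (hL : ∀ t ∈ Ici t₀, HasDerivWithinAt L (L' t) (Ici t₀) t)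
    (hS : ∀ t ∈ Ici t₀, L' t * (L t)ᵀ + L t * (L' t)ᵀ = (2 : ℝ) • S t) {t : ℝ} (ht : t ∈ Ici t₀) :
    (2 : ℝ) • (∫ ν in t₀..t, S ν) + L t₀ * (L t₀)ᵀ = L t * (L t)ᵀ := by
  have := completeSpace_matrix (n := n)
  have hG : ∀ u ∈ Ici t₀, HasDerivWithinAt (fun u => L u * (L u)ᵀ) ((2 : ℝ) • S u) (Ici t₀) u :=
    fun u hu => ((hL u hu).matrix_mul (hL u hu).matrix_transpose).congr_deriv (hS u hu)
  have hsub : uIcc t₀ t ⊆ Ici t₀ := by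
    rw [uIcc_of_le (mem_Ici.1 ht)]
    exact Icc_subset_Ici_self
  have h := integral_eq_sub_of_hasDeriv_right (a := t₀) (b := t)
    (fun u hu => (hG u (hsub hu)).continuousWithinAt.mono hsub)
    (fun u hu => (hG u (hsub (Ioo_subset_Icc_self hu))).mono
      fun v hv => mem_Ici.2 ((hsub (Ioo_subset_Icc_self hu)).out.trans (le_of_lt hv)))
    ((hSc.mono hsub).const_smul (2 : ℝ)).intervalIntegrable
  rw [← intervalIntegral.integral_smul, h, sub_add_cancel]

end

/-- For `k ∈ {1,2}`, `K` skew-symmetric valued and `S` symmetric valued,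
there is an `L_k`-matrix `L` with `L̇(t)·L(t)ᵀ = K(t) + S(t)` on `[t₀,∞)` iff `K, S` are `C¹`
and (1) there are `μ, η > 0` and a symmetric positive definite `S₀` with
`|2∫_{t₀}^t tr(S) + tr(S₀)| ≤ μ²` and `det(2∫_{t₀}^t S + S₀) ≥ η²` on `[t₀,∞)`, and
(2) all derivatives of `K` and `S` of order `≤ k − 1` are bounded on `[t₀,∞)`. -/
theorem stmt_1 {m : ℕ} (hm : 1 ≤ m) (t₀ : ℝ) (k : ℕ) (hk : k = 1 ∨ k = 2)
    (K S : ℝ → Matrix (Fin m) (Fin m) ℝ)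
    (hK : ∀ t ∈ Ici t₀, (K t)ᵀ = -K t)
    (hS : ∀ t ∈ Ici t₀, (S t)ᵀ = S t) :
    (∃ L : ℝ → Matrix (Fin m) (Fin m) ℝ, IsLkMatrix t₀ k L ∧
        ∀ t ∈ Ici t₀, derivWithin L (Ici t₀) t * (L t)ᵀ = K t + S t) ↔
      (ContDiffOn ℝ 1 K (Ici t₀) ∧ ContDiffOn ℝ 1 S (Ici t₀) ∧
        (∃ μ > (0:ℝ), ∃ η > (0:ℝ), ∃ S₀ : Matrix (Fin m) (Fin m) ℝ, S₀.PosDef ∧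
          (∀ t ∈ Ici t₀, |2 * (∫ ν in t₀..t, (S ν).trace) + S₀.trace| ≤ μ ^ 2) ∧
          (∀ t ∈ Ici t₀, η ^ 2 ≤ ((2:ℝ) • (∫ ν in t₀..t, S ν) + S₀).det)) ∧
        (∀ i < k,
          (∃ M : ℝ, ∀ t ∈ Ici t₀, ‖iteratedDerivWithin i K (Ici t₀) t‖ ≤ M) ∧
          (∃ M : ℝ, ∀ t ∈ Ici t₀, ‖iteratedDerivWithin i S (Ici t₀) t‖ ≤ M))) := by
  have hu := uniqueDiffOn_Ici t₀
  have hk2 : k ≤ 2 := by omega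
  have hone : ∀ i < k, ((i : ℕ) : WithTop ℕ∞) ≤ 1 := fun i hi => by
    exact_mod_cast (by omega : i ≤ 1)
  constructor
  · rintro ⟨L, ⟨hLc, ⟨η, hη, hdet⟩, hb⟩, hLP⟩
    set L' := derivWithin L (Ici t₀)
    have hL'c : ContDiffOn ℝ 1 L' (Ici t₀) := hLc.derivWithin hu (by norm_num)
    have hL : ∀ t ∈ Ici t₀, HasDerivWithinAt L (L' t) (Ici t₀) t := fun t ht =>
      (hLc.differentiableOn (by norm_num) t ht).hasDerivWithinAt
    set P : ℝ → Matrix (Fin m) (Fin m) ℝ := fun t => L' t * (L t)ᵀ with hP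
    have hPc : ContDiffOn ℝ 1 P (Ici t₀) :=
      hL'c.matrix_mul (hLc.of_le (by norm_num)).matrix_transpose
    have hPT : ∀ t ∈ Ici t₀, (P t)ᵀ = -K t + S t := fun t ht => by
      rw [show P t = K t + S t from hLP t ht, transpose_add, hK t ht, hS t ht]
    have hKP : EqOn K (halfAddTransposeL (-1) ∘ P) (Ici t₀) := fun t ht => by
      rw [Function.comp_apply, halfAddTransposeL_apply, hPT t ht, hP]
      simp only [hLP t ht]
      module
    have hSP : EqOn S (halfAddTransposeL 1 ∘ P) (Ici t₀) := fun t ht => by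
      rw [Function.comp_apply, halfAddTransposeL_apply, hPT t ht, hP]
      simp only [hLP t ht]
      module
    have hPb := exists_bound_iteratedDerivWithin_mul_transpose hk2 hL'c hL hP hb
    have hSc : ContDiffOn ℝ 1 S (Ici t₀) :=
      ((halfAddTransposeL 1).contDiff.comp_contDiffOn hPc).congr fun _ h => hSP h
    have hint : ∀ t ∈ Ici t₀,
        (2 : ℝ) • (∫ ν in t₀..t, S ν) + L t₀ * (L t₀)ᵀ = L t * (L t)ᵀ := fun t ht => by
      refine two_smul_integral_add_eq hSc.continuousOn hL (fun u hu => ?_) ht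
      have h := hPT u hu
      simp only [hP, transpose_mul, transpose_transpose] at h
      rw [h, hLP u hu]
      module
    have hpos : (L t₀ * (L t₀)ᵀ).PosDef := by
      have hunit : IsUnit (L t₀) := (isUnit_iff_isUnit_det _).2
        (abs_pos.1 (hη.trans_le (hdet t₀ self_mem_Ici))).isUnit
      simpa using PosDef.mul_conjTranspose_self (L t₀) (vecMul_injective_of_isUnit hunit)
    obtain ⟨M, hM⟩ := hb 0 (Nat.zero_le k)
    simp only [iteratedDerivWithin_zero] at hM
    refine ⟨((halfAddTransposeL (-1)).contDiff.comp_contDiffOn hPc).congr fun _ h => hKP h, hSc,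
      ⟨|M| + 1, by positivity, η, hη, L t₀ * (L t₀)ᵀ, hpos, fun t ht => ?_, fun t ht => ?_⟩,
      fun i hi => ⟨exists_bound_iteratedDerivWithin_clm_comp _ (hPc.of_le (hone i hi)) hKP
        (hPb i hi), exists_bound_iteratedDerivWithin_clm_comp _ (hPc.of_le (hone i hi)) hSP
        (hPb i hi)⟩⟩
    · rw [integral_matrix_trace hSc.continuousOn ht, ← smul_eq_mul, ← trace_smul, ← trace_add,
        hint t ht, ← frobenius_norm_sq_eq_trace, abs_of_nonneg (sq_nonneg _)]
      gcongr
      linarith [hM t ht, le_abs_self M]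
    · rw [hint t ht, det_mul, det_transpose, ← sq, ← sq_abs (L t).det]
      gcongr
      exact hdet t ht
  · rintro ⟨hKc, hSc, ⟨μ, hμ, η, hη, S₀, hS₀, htr, hdet⟩, hb⟩
    obtain ⟨L, L', hL'c, hL, hLP, hLG⟩ := exists_factorization hK hS hKc hSc hS₀ fun t ht =>
      (isUnit_iff_isUnit_det _).2 ((sq_pos_of_pos hη).trans_le (hdet t ht)).ne'.isUnit
    have hdL : EqOn (derivWithin L (Ici t₀)) L' (Ici t₀) :=
      fun t ht => (hL t ht).derivWithin (hu t ht)
    have hLμ : ∀ t ∈ Ici t₀, ‖L t‖ ≤ μ := fun t ht => by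
      refine (sq_le_sq₀ (norm_nonneg _) hμ.le).1 ?_
      rw [frobenius_norm_sq_eq_trace, hLG t ht, trace_add, trace_smul, smul_eq_mul,
        ← integral_matrix_trace hSc.continuousOn ht]
      exact (le_abs_self _).trans (htr t ht)
    have hLη : ∀ t ∈ Ici t₀, η ≤ |(L t).det| := fun t ht => by
      refine (sq_le_sq₀ hη.le (abs_nonneg _)).1 ?_
      have h := hdet t ht
      rwa [← hLG t ht, det_mul, det_transpose, ← sq, ← sq_abs (L t).det] at h
    refine ⟨L, ⟨?_, ⟨η, hη, hLη⟩, ?_⟩, fun t ht => by rw [hdL ht, hLP t ht]⟩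
    · rw [show (2 : WithTop ℕ∞) = 1 + 1 by norm_num, contDiffOn_succ_iff_derivWithin hu]
      exact ⟨fun t ht => (hL t ht).differentiableWithinAt, by simp, hL'c.congr hdL⟩
    · refine exists_bound_iteratedDerivWithin_of_mul_transpose (P := K + S) hk2 hL'c hL hLP hη hLμ
        hLη fun i hi => ?_
      obtain ⟨⟨M₁, h₁⟩, ⟨M₂, h₂⟩⟩ := hb i hi
      refine ⟨M₁ + M₂, fun t ht => ?_⟩
      rw [iteratedDerivWithin_add ht hu ((hKc.of_le (hone i hi)) t ht)
        ((hSc.of_le (hone i hi)) t ht)]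
      exact norm_add_le_of_le (h₁ t ht) (h₂ t ht)
end

section
/- Let k ∈ {0,1,2}, let A : [t₀,∞) → M_m(ℝ) be of class C¹ and B : [t₀,∞) → M_m(ℝ) continuous. The system ẍ + A(t)ẋ + B(t)x = 0 is L_k-equivalent to some system ξ̈ + V(t)ξ̇ + W(t)ξ = 0 with V, W continuous and V(t) = V(t)ᵀ for all t ≥ t₀ if and only if there exist a symmetric C¹ matrix function S : [t₀,∞) → M_m(ℝ) and a symmetric positive definite S₀ ∈ M_m(ℝ) such that, setting Λ(t) = 2∫_{t₀}^t S(ν) dν + S₀ and K(t) = (Λ(t)A(t)ᵀ − A(t)Λ(t))/4, the following hold: (1) there exist μ > 0, η > 0 with |tr(Λ(t))| ≤ μ² and det(Λ(t)) ≥ η² for all t ≥ t₀; (2) if k ≥ 1, then sup_{t≥t₀} ‖(d^i/dt^i)K(t)‖ + sup_{t≥t₀} ‖(d^i/dt^i)S(t)‖ < ∞ for every 0 ≤ i ≤ k−1. -/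
open Matrix Set intervalIntegral

attribute [local instance] Matrix.frobeniusNormedAddCommGroup Matrix.frobeniusNormedSpace

/-- The system `ẍ + A(t)ẋ + B(t)x = 0` is `L_k`-equivalent to `ξ̈ + V(t)ξ̇ + W(t)ξ = 0`:
there is an `L_k`-matrix `L` with `V(t) = L(t)⁻¹(2L̇(t) + A(t)L(t))` and
`W(t) = L(t)⁻¹(L̈(t) + A(t)L̇(t) + B(t)L(t))` for all `t ≥ t₀`. -/
def LkEquiv (t₀ : ℝ) (k : ℕ) {m : ℕ} (A B V W : ℝ → Matrix (Fin m) (Fin m) ℝ) : Prop :=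
  ∃ L : ℝ → Matrix (Fin m) (Fin m) ℝ, IsLkMatrix t₀ k L ∧
    ∀ t ∈ Ici t₀,
      V t = (L t)⁻¹ * ((2:ℝ) • derivWithin L (Ici t₀) t + A t * L t) ∧
      W t = (L t)⁻¹ * (derivWithin (derivWithin L (Ici t₀)) (Ici t₀) t
              + A t * derivWithin L (Ici t₀) t + B t * L t)

/-- `Λ(t) = 2∫_{t₀}^t S(ν) dν + S₀`. -/
noncomputable def Lam (t₀ : ℝ) {m : ℕ} (S : ℝ → Matrix (Fin m) (Fin m) ℝ)
    (S₀ : Matrix (Fin m) (Fin m) ℝ) (t : ℝ) : Matrix (Fin m) (Fin m) ℝ :=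
  (2:ℝ) • (∫ ν in t₀..t, S ν) + S₀

section LinearODE

variable {E : Type*} [NormedAddCommGroup E] [NormedSpace ℝ E]

/-- The terms of the Picard series of the linear equation `x' = F x`, `x t₀ = x₀`. -/
noncomputable def picardTerm (F : ℝ → E →L[ℝ] E) (t₀ : ℝ) (x₀ : E) : ℕ → ℝ → E
  | 0 => fun _ => x₀
  | n + 1 => fun t => ∫ s in t₀..t, F s (picardTerm F t₀ x₀ n s)

variable {F : ℝ → E →L[ℝ] E}

theorem continuous_picardTerm (hF : Continuous F) (t₀ : ℝ) (x₀ : E) (n : ℕ) : Continuous (picardTerm F t₀ x₀ n) := by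
  induction n with
  | zero => exact continuous_const
  | succ n ih =>
    exact intervalIntegral.continuous_primitive
      (fun a b => (hF.clm_apply ih).intervalIntegrable a b) t₀

theorem norm_picardTerm_le (hF : Continuous F) (t₀ : ℝ) (x₀ : E) {R C : ℝ}
    (hC : ∀ t ∈ Metric.closedBall t₀ R, ‖F t‖ ≤ C) (n : ℕ) :
    ∀ t ∈ Metric.closedBall t₀ R,
      ‖picardTerm F t₀ x₀ n t‖ ≤ ‖x₀‖ * ((C * |t - t₀|) ^ n / n.factorial) := by
  induction n with
  | zero => intro t _; simp [picardTerm]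
  | succ n ih =>
    intro t ht
    have hsub : ∀ s ∈ uIoc t₀ t, s ∈ Metric.closedBall t₀ R := by
      intro s hs
      have h := abs_sub_left_of_mem_uIcc (uIoc_subset_uIcc hs)
      rw [Metric.mem_closedBall, Real.dist_eq] at ht ⊢
      exact h.trans ht
    calc ‖picardTerm F t₀ x₀ (n + 1) t‖
        ≤ ∫ s in uIoc t₀ t, ‖F s (picardTerm F t₀ x₀ n s)‖ :=
          intervalIntegral.norm_integral_le_integral_norm_uIoc
      _ ≤ ∫ s in uIoc t₀ t, C * ‖x₀‖ * C ^ n / n.factorial * |s - t₀| ^ n := by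
          refine MeasureTheory.setIntegral_mono_on ?_ ?_ measurableSet_uIoc fun s hs => ?_
          · exact ((hF.clm_apply (continuous_picardTerm hF t₀ x₀ n)).norm.intervalIntegrable
              t₀ t).def'
          · exact (Continuous.intervalIntegrable (by fun_prop) t₀ t).def'
          · calc ‖F s (picardTerm F t₀ x₀ n s)‖
                ≤ C * (‖x₀‖ * ((C * |s - t₀|) ^ n / n.factorial)) :=
                  (F s).le_of_opNorm_le_of_le (hC s (hsub s hs)) (ih s (hsub s hs))
              _ = _ := by rw [mul_pow]; ring
      _ = ‖x₀‖ * ((C * |t - t₀|) ^ (n + 1) / (n + 1).factorial) := by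
          rw [MeasureTheory.integral_const_mul, integral_pow_abs_sub_uIoc, Nat.factorial_succ,
            mul_pow]
          push_cast
          field_simp
          ring

variable [CompleteSpace E]

theorem hasDerivAt_picardTerm_succ (hF : Continuous F) (t₀ : ℝ) (x₀ : E) (n : ℕ) (t : ℝ) :
    HasDerivAt (picardTerm F t₀ x₀ (n + 1)) (F t (picardTerm F t₀ x₀ n t)) t :=
  (hF.clm_apply (continuous_picardTerm hF t₀ x₀ n)).integral_hasStrictDerivAt t₀ t |>.hasDerivAt

/-- Global existence for linear ordinary differential equations with continuous coefficients. -/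
theorem exists_hasDerivAt_of_linear (hF : Continuous F) (t₀ : ℝ) (x₀ : E) :
    ∃ x : ℝ → E, x t₀ = x₀ ∧ ∀ t, HasDerivAt x (F t (x t)) t := by
  refine ⟨fun t => ∑' n, picardTerm F t₀ x₀ n t, ?_, fun t => ?_⟩
  · change ∑' n, picardTerm F t₀ x₀ n t₀ = x₀
    rw [tsum_eq_single 0]
    · rfl
    · rintro (_ | n) hn
      · exact absurd rfl hn
      · exact intervalIntegral.integral_same
  obtain ⟨R, hR⟩ : ∃ R, dist t t₀ < R := exists_gt _
  have hR0 : 0 < R := dist_nonneg.trans_lt hR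
  obtain ⟨C, hC⟩ := (isCompact_closedBall t₀ R).exists_bound_of_continuousOn hF.continuousOn
  have hC0 : 0 ≤ C := (norm_nonneg _).trans (hC t₀ (Metric.mem_closedBall_self hR0.le))
  have hbound : ∀ n, ∀ y ∈ Metric.ball t₀ R,
      ‖picardTerm F t₀ x₀ n y‖ ≤ ‖x₀‖ * ((C * R) ^ n / n.factorial) := by
    intro n y hy
    refine (norm_picardTerm_le hF t₀ x₀ hC n y (Metric.ball_subset_closedBall hy)).trans ?_
    have : |y - t₀| ≤ R := (Metric.mem_ball.1 hy).le
    gcongr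
  have hsum : Summable fun n : ℕ => ‖x₀‖ * ((C * R) ^ n / n.factorial) :=
    (Real.summable_pow_div_factorial _).mul_left _
  let g' : ℕ → ℝ → E := fun n y => n.casesOn 0 fun k => F y (picardTerm F t₀ x₀ k y)
  let u : ℕ → ℝ := fun n => n.casesOn 0 fun k => C * (‖x₀‖ * ((C * R) ^ k / k.factorial))
  have hu : Summable u := (summable_nat_add_iff 1).1 (hsum.mul_left C)
  have hX : ∀ y ∈ Metric.ball t₀ R, Summable fun n => picardTerm F t₀ x₀ n y := fun y hy =>
    .of_norm_bounded hsum fun n => hbound n y hy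
  have hg' : ∀ n, ∀ y ∈ Metric.ball t₀ R, ‖g' n y‖ ≤ u n := by
    rintro (_ | n) y hy
    · simp [g', u]
    · exact (F y).le_of_opNorm_le_of_le (hC y (Metric.ball_subset_closedBall hy)) (hbound n y hy)
  have key := hasDerivAt_tsum_of_isPreconnected (g := picardTerm F t₀ x₀) (g' := g') hu
    Metric.isOpen_ball (convex_ball t₀ R).isPreconnected (y := t) (y₀ := t₀) ?_ hg'
    (Metric.mem_ball_self hR0) (hX t₀ (Metric.mem_ball_self hR0)) hR
  · convert key using 1
    have hs : Summable fun n => g' n t := .of_norm_bounded hu fun n => hg' n t hR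
    rw [hs.tsum_eq_zero_add, (F t).map_tsum (hX t hR)]
    simp [g']
  · rintro (_ | n) y _
    · exact hasDerivAt_const y x₀
    · exact hasDerivAt_picardTerm_succ hF t₀ x₀ n y

end LinearODE

section MatrixCalculus

attribute [local instance] Matrix.frobeniusNormedRing Matrix.frobeniusNormedAlgebra

variable {m : ℕ}

/-- Transposition of square real matrices as a continuous linear map. -/
noncomputable def transposeCLM : Matrix (Fin m) (Fin m) ℝ →L[ℝ] Matrix (Fin m) (Fin m) ℝ :=
  LinearMap.toContinuousLinearMap
    (Matrix.transposeLinearEquiv (Fin m) (Fin m) ℝ ℝ).toLinearMap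

variable {L M : ℝ → Matrix (Fin m) (Fin m) ℝ} {s : Set ℝ} {t : ℝ}

theorem hasDerivWithinAt_matrix_transpose {X : Matrix (Fin m) (Fin m) ℝ}
    (h : HasDerivWithinAt L X s t) : HasDerivWithinAt (fun τ => (L τ)ᵀ) Xᵀ s t :=
  (transposeCLM (m := m)).hasFDerivAt.comp_hasDerivWithinAt t h

theorem hasDerivWithinAt_matrix_mul {X Y : Matrix (Fin m) (Fin m) ℝ}
    (hL : HasDerivWithinAt L X s t) (hM : HasDerivWithinAt M Y s t) :
    HasDerivWithinAt (fun τ => L τ * M τ) (X * M t + L t * Y) s t :=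
  hL.mul hM

theorem contDiffOn_matrix_transpose {n : WithTop ℕ∞} (h : ContDiffOn ℝ n L s) :
    ContDiffOn ℝ n (fun τ => (L τ)ᵀ) s :=
  (transposeCLM (m := m)).contDiff.comp_contDiffOn h

theorem contDiffOn_matrix_mul {n : WithTop ℕ∞} (hL : ContDiffOn ℝ n L s)
    (hM : ContDiffOn ℝ n M s) : ContDiffOn ℝ n (fun τ => L τ * M τ) s :=
  hL.mul hM

theorem continuousOn_matrix_mul (hL : ContinuousOn L s) (hM : ContinuousOn M s) :
    ContinuousOn (fun τ => L τ * M τ) s :=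
  hL.mul hM

theorem contDiffOn_matrix_inv {n : WithTop ℕ∞} (hL : ContDiffOn ℝ n L s)
    (h : ∀ τ ∈ s, (L τ).det ≠ 0) : ContDiffOn ℝ n (fun τ => (L τ)⁻¹) s := by
  intro τ hτ
  obtain ⟨U, hU⟩ := (Matrix.isUnit_iff_isUnit_det _).2 (h τ hτ).isUnit
  have hinv : ContDiffAt ℝ n Ring.inverse (L τ) := hU ▸ contDiffAt_ringInverse ℝ U
  simp_rw [Matrix.nonsing_inv_eq_ringInverse]
  exact hinv.comp_contDiffWithinAt τ (hL τ hτ)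

theorem trace_mul_transpose_self_eq (X : Matrix (Fin m) (Fin m) ℝ) :
    (X * Xᵀ).trace = ‖X‖ ^ 2 := by
  rw [Matrix.frobenius_norm_def, ← Real.sqrt_eq_rpow, Real.sq_sqrt (by positivity)]
  simp [Matrix.trace, Matrix.mul_apply, sq]

/-- A linear matrix equation `X' = F X` on a half-line with continuous coefficient is solvable. -/
theorem exists_hasDerivWithinAt_mul {F : ℝ → Matrix (Fin m) (Fin m) ℝ} {t₀ : ℝ}
    (hF : ContinuousOn F (Ici t₀)) (X₀ : Matrix (Fin m) (Fin m) ℝ) :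
    ∃ X : ℝ → Matrix (Fin m) (Fin m) ℝ, X t₀ = X₀ ∧
      ∀ t ∈ Ici t₀, HasDerivWithinAt X (F t * X t) (Ici t₀) t := by
  have hG : Continuous fun t => F (max t t₀) :=
    hF.comp_continuous (by fun_prop) fun t => le_max_right t t₀
  obtain ⟨X, hX₀, hX⟩ := exists_hasDerivAt_of_linear
    ((ContinuousLinearMap.mul ℝ (Matrix (Fin m) (Fin m) ℝ)).continuous.comp hG) t₀ X₀
  refine ⟨X, hX₀, fun t ht => ?_⟩
  have h := (hX t).hasDerivWithinAt (s := Ici t₀)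
  rwa [Function.comp_apply, max_eq_left ht] at h

/-- Uniqueness for the homogeneous equation `D' = F D + D G` on a half-line. -/
theorem eq_zero_of_hasDerivWithinAt_mul_add_mul {D F G : ℝ → Matrix (Fin m) (Fin m) ℝ} {t₀ : ℝ}
    (hF : ContinuousOn F (Ici t₀)) (hG : ContinuousOn G (Ici t₀)) (h₀ : D t₀ = 0)
    (hD : ∀ t ∈ Ici t₀, HasDerivWithinAt D (F t * D t + D t * G t) (Ici t₀) t) :
    ∀ t ∈ Ici t₀, D t = 0 := by
  intro T hT
  have hsub : Icc t₀ T ⊆ Ici t₀ := Icc_subset_Ici_self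
  obtain ⟨C, hC⟩ := isCompact_Icc.exists_bound_of_continuousOn (hF.mono hsub)
  obtain ⟨C', hC'⟩ := isCompact_Icc.exists_bound_of_continuousOn (hG.mono hsub)
  have h := norm_le_gronwallBound_of_norm_deriv_right_le (f := D) (δ := 0) (K := C + C') (ε := 0)
    (a := t₀) (b := T) (fun t ht => ((hD t (hsub ht)).mono hsub).continuousWithinAt)
    (fun t ht => (hD t ht.1).mono (Ici_subset_Ici.2 ht.1)) (by simp [h₀]) (fun t ht => ?_)
    T ⟨hT, le_rfl⟩
  · simpa [gronwallBound_ε0] using h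
  · have ht' := Ico_subset_Icc_self ht
    calc ‖F t * D t + D t * G t‖ ≤ ‖F t‖ * ‖D t‖ + ‖D t‖ * ‖G t‖ :=
          (norm_add_le _ _).trans (add_le_add (norm_mul_le _ _) (norm_mul_le _ _))
      _ ≤ C * ‖D t‖ + ‖D t‖ * C' := by
          gcongr
          · exact hC t ht'
          · exact hC' t ht'
      _ = _ := by ring

/-- `f` is bounded in norm on `s`. -/
def NormBddOn (f : ℝ → Matrix (Fin m) (Fin m) ℝ) (s : Set ℝ) : Prop :=
  ∃ M : ℝ, ∀ t ∈ s, ‖f t‖ ≤ M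

namespace NormBddOn

variable {f g : ℝ → Matrix (Fin m) (Fin m) ℝ}

theorem congr (hf : NormBddOn f s) (h : ∀ t ∈ s, g t = f t) : NormBddOn g s := by
  obtain ⟨M, hM⟩ := hf
  exact ⟨M, fun t ht => h t ht ▸ hM t ht⟩

theorem add (hf : NormBddOn f s) (hg : NormBddOn g s) : NormBddOn (fun t => f t + g t) s := by
  obtain ⟨M, hM⟩ := hf
  obtain ⟨N, hN⟩ := hg
  exact ⟨M + N, fun t ht => norm_add_le_of_le (hM t ht) (hN t ht)⟩

theorem sub (hf : NormBddOn f s) (hg : NormBddOn g s) : NormBddOn (fun t => f t - g t) s := by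
  obtain ⟨M, hM⟩ := hf
  obtain ⟨N, hN⟩ := hg
  exact ⟨M + N, fun t ht => norm_sub_le_of_le (hM t ht) (hN t ht)⟩

theorem mul (hf : NormBddOn f s) (hg : NormBddOn g s) : NormBddOn (fun t => f t * g t) s := by
  obtain ⟨M, hM⟩ := hf
  obtain ⟨N, hN⟩ := hg
  exact ⟨M * N, fun t ht => norm_mul_le_of_le (hM t ht) (hN t ht)⟩

theorem const_smul (c : ℝ) (hf : NormBddOn f s) : NormBddOn (fun t => c • f t) s := by
  obtain ⟨M, hM⟩ := hf
  refine ⟨|c| * M, fun t ht => ?_⟩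
  rw [norm_smul, Real.norm_eq_abs]
  exact mul_le_mul_of_nonneg_left (hM t ht) (abs_nonneg c)

theorem transpose (hf : NormBddOn f s) : NormBddOn (fun t => (f t)ᵀ) s := by
  obtain ⟨M, hM⟩ := hf
  exact ⟨M, fun t ht => (Matrix.frobenius_norm_transpose (f t)).trans_le (hM t ht)⟩

theorem inv (hf : NormBddOn f s) {η : ℝ} (hη : 0 < η) (hdet : ∀ t ∈ s, η ≤ |(f t).det|) :
    NormBddOn (fun t => (f t)⁻¹) s := by
  obtain ⟨M, hM⟩ := hf
  obtain ⟨N, hN⟩ := (isCompact_closedBall (0 : Matrix (Fin m) (Fin m) ℝ) M)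
    |>.exists_bound_of_continuousOn (f := Matrix.adjugate)
      (Continuous.matrix_adjugate continuous_id).continuousOn
  refine ⟨η⁻¹ * N, fun t ht => ?_⟩
  change ‖(f t)⁻¹‖ ≤ _
  rw [Matrix.inv_def, norm_smul, Ring.inverse_eq_inv', norm_inv, Real.norm_eq_abs]
  have h1 : |(f t).det|⁻¹ ≤ η⁻¹ := inv_anti₀ hη (hdet t ht)
  have h2 : ‖(f t).adjugate‖ ≤ N := hN _ (by simpa using hM t ht)
  gcongr

end NormBddOn

end MatrixCalculus

section SymmetricEquivalence

variable {m : ℕ} {t₀ : ℝ} {L S A : ℝ → Matrix (Fin m) (Fin m) ℝ} {S₀ : Matrix (Fin m) (Fin m) ℝ}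

theorem iteratedDerivWithin_two_Ici (f : ℝ → Matrix (Fin m) (Fin m) ℝ) (t : ℝ) :
    iteratedDerivWithin 2 f (Ici t₀) t
      = derivWithin (derivWithin f (Ici t₀)) (Ici t₀) t := by
  rw [iteratedDerivWithin_succ, iteratedDerivWithin_one]
  rfl

theorem normBddOn_iteratedDerivWithin_one {f f' : ℝ → Matrix (Fin m) (Fin m) ℝ}
    (h : ∀ t ∈ Ici t₀, HasDerivWithinAt f (f' t) (Ici t₀) t) (hf' : NormBddOn f' (Ici t₀)) :
    NormBddOn (iteratedDerivWithin 1 f (Ici t₀)) (Ici t₀) :=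
  hf'.congr fun t ht => by
    rw [iteratedDerivWithin_one, (h t ht).derivWithin (uniqueDiffOn_Ici t₀ t ht)]

theorem hasDerivWithinAt_derivWithin_Ici {n : WithTop ℕ∞} (h : ContDiffOn ℝ n L (Ici t₀))
    (hn : n ≠ 0) {t : ℝ} (ht : t ∈ Ici t₀) :
    HasDerivWithinAt L (derivWithin L (Ici t₀) t) (Ici t₀) t :=
  (h.differentiableOn hn t ht).hasDerivWithinAt

theorem contDiffOn_derivWithin_Ici (h : ContDiffOn ℝ 2 L (Ici t₀)) :
    ContDiffOn ℝ 1 (derivWithin L (Ici t₀)) (Ici t₀) :=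
  h.derivWithin (uniqueDiffOn_Ici t₀) (by norm_num)

/-- Symmetry of the transformed first order coefficient, expressed through `L Lᵀ`. -/
theorem transpose_inv_mul_eq_iff {X Y Z : Matrix (Fin m) (Fin m) ℝ} (hX : X.det ≠ 0) :
    (X⁻¹ * ((2 : ℝ) • Y + Z * X))ᵀ = X⁻¹ * ((2 : ℝ) • Y + Z * X) ↔
      (1 / 4 : ℝ) • (X * Xᵀ * Zᵀ - Z * (X * Xᵀ)) = (1 / 2 : ℝ) • (Y * Xᵀ - X * Yᵀ) := by
  have hu : IsUnit X.det := hX.isUnit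
  have hu' : IsUnit Xᵀ.det := by rwa [Matrix.det_transpose]
  set V := X⁻¹ * ((2 : ℝ) • Y + Z * X) with hV
  have hXV : X * V = (2 : ℝ) • Y + Z * X := Matrix.mul_nonsing_inv_cancel_left X _ hu
  have h1 : X * V * Xᵀ = (2 : ℝ) • (Y * Xᵀ) + Z * (X * Xᵀ) := by
    rw [hXV, add_mul, smul_mul_assoc, mul_assoc]
  have h2 : X * Vᵀ * Xᵀ = (2 : ℝ) • (X * Yᵀ) + X * Xᵀ * Zᵀ := by
    have := congrArg Matrix.transpose h1
    simpa [Matrix.transpose_mul, mul_assoc] using this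
  have h3 : Vᵀ = V ↔ X * Vᵀ * Xᵀ = X * V * Xᵀ := by
    refine ⟨fun h => by rw [h], fun h => ?_⟩
    have h' := congrArg (fun W => X⁻¹ * (W * Xᵀ⁻¹)) h
    simpa [Matrix.mul_nonsing_inv_cancel_right _ _ hu',
      Matrix.nonsing_inv_mul_cancel_left _ _ hu] using h'
  rw [h3, h1, h2]
  constructor <;> intro h
  · linear_combination (norm := module) (1 / 4 : ℝ) • h
  · linear_combination (norm := module) (4 : ℝ) • h

theorem hasDerivWithinAt_Lam (hS : ContinuousOn S (Ici t₀)) {t : ℝ} (ht : t ∈ Ici t₀) :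
    HasDerivWithinAt (Lam t₀ S S₀) ((2 : ℝ) • S t) (Ici t₀) t := by
  have hG : Continuous fun τ => S (max τ t₀) :=
    hS.comp_continuous (by fun_prop) fun τ => le_max_right τ t₀
  have h := ((((hG.integral_hasStrictDerivAt t₀ t).hasDerivAt).const_smul (2 : ℝ)).add_const
    S₀).hasDerivWithinAt (s := Ici t₀)
  rw [max_eq_left ht] at h
  have hcongr : ∀ τ ∈ Ici t₀, Lam t₀ S S₀ τ
      = (2 : ℝ) • (∫ ν in t₀..τ, S (max ν t₀)) + S₀ := by
    intro τ hτ
    unfold Lam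
    congr 2
    refine intervalIntegral.integral_congr fun ν hν => ?_
    rw [uIcc_of_le hτ] at hν
    rw [max_eq_left hν.1]
  exact h.congr hcongr (hcongr t ht)

theorem Lam_self : Lam t₀ S S₀ t₀ = S₀ := by simp [Lam]

theorem transpose_Lam (hS : ContinuousOn S (Ici t₀)) (hsymm : ∀ t ∈ Ici t₀, (S t)ᵀ = S t)
    (hS₀ : S₀ᵀ = S₀) {t : ℝ} (ht : t ∈ Ici t₀) : (Lam t₀ S S₀ t)ᵀ = Lam t₀ S S₀ t := by
  refine sub_eq_zero.1 (eq_zero_of_hasDerivWithinAt_mul_add_mul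
    (D := fun τ => (Lam t₀ S S₀ τ)ᵀ - Lam t₀ S S₀ τ) (F := 0) (G := 0) continuousOn_const
    continuousOn_const (by simp [Lam_self, hS₀]) (fun τ hτ => ?_) t ht)
  have h := hasDerivWithinAt_Lam (S₀ := S₀) hS hτ
  refine ((hasDerivWithinAt_matrix_transpose h).sub h).congr_deriv ?_
  simp [hsymm τ hτ]

theorem Lam_eq_of_hasDerivWithinAt {P : ℝ → Matrix (Fin m) (Fin m) ℝ}
    (hS : ContinuousOn S (Ici t₀))
    (hP : ∀ t ∈ Ici t₀, HasDerivWithinAt P ((2 : ℝ) • S t) (Ici t₀) t) {t : ℝ}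
    (ht : t ∈ Ici t₀) : Lam t₀ S (P t₀) t = P t := by
  refine sub_eq_zero.1 (eq_zero_of_hasDerivWithinAt_mul_add_mul
    (D := fun τ => Lam t₀ S (P t₀) τ - P τ) (F := 0) (G := 0) continuousOn_const
    continuousOn_const (by simp [Lam_self]) (fun τ hτ => ?_) t ht)
  refine ((hasDerivWithinAt_Lam hS hτ).sub (hP τ hτ)).congr_deriv ?_
  simp

theorem contDiffOn_Lam {n : ℕ} (hS : ContDiffOn ℝ n S (Ici t₀)) :
    ContDiffOn ℝ (n + 1) (Lam t₀ S S₀) (Ici t₀) := by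
  have h := fun t (ht : t ∈ Ici t₀) => hasDerivWithinAt_Lam (S₀ := S₀) hS.continuousOn ht
  refine (contDiffOn_succ_iff_derivWithin (uniqueDiffOn_Ici t₀)).2
    ⟨fun t ht => (h t ht).differentiableWithinAt, by simp, ?_⟩
  exact (hS.const_smul (2 : ℝ)).congr fun t ht => (h t ht).derivWithin (uniqueDiffOn_Ici t₀ t ht)

/-- A transforming matrix with symmetric transformed coefficient yields `S` and `S₀`. -/
theorem exists_symm_of_isLkMatrix {k : ℕ} (hk : k ≤ 2) (hL : IsLkMatrix t₀ k L)
    (hV : ∀ t ∈ Ici t₀, ((L t)⁻¹ * ((2 : ℝ) • derivWithin L (Ici t₀) t + A t * L t))ᵀ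
      = (L t)⁻¹ * ((2 : ℝ) • derivWithin L (Ici t₀) t + A t * L t)) :
    ∃ S : ℝ → Matrix (Fin m) (Fin m) ℝ, ∃ S₀ : Matrix (Fin m) (Fin m) ℝ,
      ContDiffOn ℝ 1 S (Ici t₀) ∧ (∀ t ∈ Ici t₀, (S t)ᵀ = S t) ∧ S₀.PosDef ∧
      (∃ μ > (0 : ℝ), ∃ η > (0 : ℝ),
        (∀ t ∈ Ici t₀, |(Lam t₀ S S₀ t).trace| ≤ μ ^ 2) ∧
        (∀ t ∈ Ici t₀, η ^ 2 ≤ (Lam t₀ S S₀ t).det)) ∧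
      ∀ i < k,
        NormBddOn (iteratedDerivWithin i
          (fun τ => (1 / 4 : ℝ) • (Lam t₀ S S₀ τ * (A τ)ᵀ - A τ * Lam t₀ S S₀ τ)) (Ici t₀))
          (Ici t₀) ∧
        NormBddOn (iteratedDerivWithin i S (Ici t₀)) (Ici t₀) := by
  obtain ⟨hL2, ⟨η, hη, hdet⟩, hbdd⟩ := hL
  have hne : ∀ t ∈ Ici t₀, (L t).det ≠ 0 := fun t ht => abs_pos.1 (hη.trans_le (hdet t ht))
  set L₁ := derivWithin L (Ici t₀)
  set L₂ := derivWithin L₁ (Ici t₀)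
  have hL1 : ContDiffOn ℝ 1 L₁ (Ici t₀) := contDiffOn_derivWithin_Ici hL2
  have hd : ∀ t ∈ Ici t₀, HasDerivWithinAt L (L₁ t) (Ici t₀) t :=
    fun t ht => hasDerivWithinAt_derivWithin_Ici hL2 two_ne_zero ht
  have hd₁ : ∀ t ∈ Ici t₀, HasDerivWithinAt L₁ (L₂ t) (Ici t₀) t :=
    fun t ht => hasDerivWithinAt_derivWithin_Ici hL1 one_ne_zero ht
  have hG : ∀ t ∈ Ici t₀, HasDerivWithinAt (fun τ => L₁ τ * (L τ)ᵀ)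
      (L₂ t * (L t)ᵀ + L₁ t * (L₁ t)ᵀ) (Ici t₀) t := fun t ht =>
    hasDerivWithinAt_matrix_mul (hd₁ t ht) (hasDerivWithinAt_matrix_transpose (hd t ht))
  have hG' : ∀ t ∈ Ici t₀, HasDerivWithinAt (fun τ => L τ * (L₁ τ)ᵀ)
      (L₁ t * (L₁ t)ᵀ + L t * (L₂ t)ᵀ) (Ici t₀) t := fun t ht =>
    hasDerivWithinAt_matrix_mul (hd t ht) (hasDerivWithinAt_matrix_transpose (hd₁ t ht))
  set S : ℝ → Matrix (Fin m) (Fin m) ℝ :=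
    fun t => (1 / 2 : ℝ) • (L₁ t * (L t)ᵀ + L t * (L₁ t)ᵀ) with hSdef
  have hL1' : ContDiffOn ℝ 1 L (Ici t₀) := hL2.of_le (by norm_num)
  have hS : ContDiffOn ℝ 1 S (Ici t₀) :=
    ((contDiffOn_matrix_mul hL1 (contDiffOn_matrix_transpose hL1')).add
      (contDiffOn_matrix_mul hL1' (contDiffOn_matrix_transpose hL1))).const_smul (1 / 2 : ℝ)
  have hLam : ∀ t ∈ Ici t₀, Lam t₀ S (L t₀ * (L t₀)ᵀ) t = L t * (L t)ᵀ := by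
    refine fun t ht => Lam_eq_of_hasDerivWithinAt (P := fun τ => L τ * (L τ)ᵀ)
      hS.continuousOn (fun τ hτ => ?_) ht
    refine (hasDerivWithinAt_matrix_mul (hd τ hτ)
      (hasDerivWithinAt_matrix_transpose (hd τ hτ))).congr_deriv ?_
    simp [hSdef, smul_smul]
  have hK : ∀ t ∈ Ici t₀, (1 / 4 : ℝ) • (Lam t₀ S (L t₀ * (L t₀)ᵀ) t * (A t)ᵀ
      - A t * Lam t₀ S (L t₀ * (L t₀)ᵀ) t)
      = (1 / 2 : ℝ) • (L₁ t * (L t)ᵀ - L t * (L₁ t)ᵀ) := fun t ht => by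
    rw [hLam t ht]
    exact (transpose_inv_mul_eq_iff (hne t ht)).1 (hV t ht)
  have hb : NormBddOn L (Ici t₀) := by
    simpa [NormBddOn] using hbdd 0 (Nat.zero_le k)
  have hb₁ (h : 1 ≤ k) : NormBddOn L₁ (Ici t₀) :=
    NormBddOn.congr (hbdd 1 h) fun t _ => congrFun iteratedDerivWithin_one.symm t
  have hb₂ (h : 2 ≤ k) : NormBddOn L₂ (Ici t₀) :=
    NormBddOn.congr (hbdd 2 h) fun t _ => (iteratedDerivWithin_two_Ici L t).symm
  refine ⟨S, L t₀ * (L t₀)ᵀ, hS, fun t _ => ?_, ?_, ?_, fun i hi => ?_⟩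
  · simp [hSdef, add_comm]
  · rw [← Matrix.conjTranspose_eq_transpose_of_trivial]
    exact Matrix.PosDef.mul_conjTranspose_self _ (Matrix.vecMul_injective_of_isUnit
      ((Matrix.isUnit_iff_isUnit_det _).2 (hne t₀ self_mem_Ici).isUnit))
  · obtain ⟨M, hM⟩ := hb
    refine ⟨|M| + 1, by positivity, η, hη, fun t ht => ?_, fun t ht => ?_⟩
    · rw [hLam t ht, trace_mul_transpose_self_eq, abs_of_nonneg (by positivity)]
      have h := (hM t ht).trans (le_abs_self M)
      gcongr
      linarith
    · rw [hLam t ht, Matrix.det_mul, Matrix.det_transpose, ← sq, ← sq_abs (L t).det]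
      exact pow_le_pow_left₀ hη.le (hdet t ht) 2
  · match i, hi with
    | 0, hi =>
      have h₁ := hb₁ hi
      simp only [iteratedDerivWithin_zero]
      exact ⟨(((h₁.mul hb.transpose).sub (hb.mul h₁.transpose)).const_smul _).congr hK,
        ((h₁.mul hb.transpose).add (hb.mul h₁.transpose)).const_smul _⟩
    | 1, hi =>
      have h₁ := hb₁ hi.le
      have h₂ := hb₂ hi
      have hg := (h₂.mul hb.transpose).add (h₁.mul h₁.transpose)
      have hg' := (h₁.mul h₁.transpose).add (hb.mul h₂.transpose)
      exact ⟨normBddOn_iteratedDerivWithin_one (fun t ht =>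
          (((hG t ht).sub (hG' t ht)).const_smul (1 / 2 : ℝ)).congr hK (hK t ht))
          ((hg.sub hg').const_smul _),
        normBddOn_iteratedDerivWithin_one (fun t ht =>
          ((hG t ht).add (hG' t ht)).const_smul (1 / 2 : ℝ)) ((hg.add hg').const_smul _)⟩
    | i + 2, hi => omega

open scoped MatrixOrder in
theorem exists_eq_transpose_mul_self {P : Matrix (Fin m) (Fin m) ℝ} (hP : P.PosSemidef) :
    ∃ C : Matrix (Fin m) (Fin m) ℝ, P = Cᵀ * C := by
  obtain ⟨C, hC⟩ := CStarAlgebra.nonneg_iff_eq_star_mul_self.mp hP.nonneg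
  rw [Matrix.star_eq_conjTranspose, Matrix.conjTranspose_eq_transpose_of_trivial] at hC
  exact ⟨C, hC⟩

/-- A factorization `Λ = L Lᵀ` of a symmetric path, with prescribed skew part of `L' Lᵀ`. -/
theorem exists_factorization_s2 {K Λ : ℝ → Matrix (Fin m) (Fin m) ℝ}
    (hS : ContDiffOn ℝ 1 S (Ici t₀)) (hK : ContDiffOn ℝ 1 K (Ici t₀))
    (hΛ : ∀ t ∈ Ici t₀, HasDerivWithinAt Λ ((2 : ℝ) • S t) (Ici t₀) t)
    (hΛ1 : ContDiffOn ℝ 1 Λ (Ici t₀))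
    (hSsymm : ∀ t ∈ Ici t₀, (S t)ᵀ = S t) (hKskew : ∀ t ∈ Ici t₀, (K t)ᵀ = -K t)
    (hΛsymm : ∀ t ∈ Ici t₀, (Λ t)ᵀ = Λ t) (hdet : ∀ t ∈ Ici t₀, (Λ t).det ≠ 0)
    (hpos : (Λ t₀).PosSemidef) :
    ∃ L : ℝ → Matrix (Fin m) (Fin m) ℝ, ContDiffOn ℝ 2 L (Ici t₀) ∧
      ∀ t ∈ Ici t₀, L t * (L t)ᵀ = Λ t ∧ derivWithin L (Ici t₀) t * (L t)ᵀ = S t + K t := by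
  set F : ℝ → Matrix (Fin m) (Fin m) ℝ := fun t => (S t + K t) * (Λ t)⁻¹ with hFdef
  have hF : ContDiffOn ℝ 1 F (Ici t₀) :=
    contDiffOn_matrix_mul (hS.add hK) (contDiffOn_matrix_inv hΛ1 hdet)
  obtain ⟨C, hC⟩ := exists_eq_transpose_mul_self hpos
  obtain ⟨L, hL₀, hL⟩ := exists_hasDerivWithinAt_mul hF.continuousOn Cᵀ
  have hderiv : ∀ t ∈ Ici t₀, derivWithin L (Ici t₀) t = F t * L t :=
    fun t ht => (hL t ht).derivWithin (uniqueDiffOn_Ici t₀ t ht)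
  have hLdiff : DifferentiableOn ℝ L (Ici t₀) := fun t ht => (hL t ht).differentiableWithinAt
  have hL1 : ContDiffOn ℝ 1 L (Ici t₀) := by
    rw [contDiffOn_one_iff_derivWithin (uniqueDiffOn_Ici t₀)]
    refine ⟨hLdiff, ContinuousOn.congr ?_ hderiv⟩
    exact continuousOn_matrix_mul hF.continuousOn hLdiff.continuousOn
  have hL2 : ContDiffOn ℝ 2 L (Ici t₀) := by
    rw [← one_add_one_eq_two, contDiffOn_succ_iff_derivWithin (uniqueDiffOn_Ici t₀)]
    exact ⟨hLdiff, by simp, (contDiffOn_matrix_mul hF hL1).congr hderiv⟩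
  have hFΛ : ∀ t ∈ Ici t₀, F t * Λ t = S t + K t := fun t ht =>
    Matrix.nonsing_inv_mul_cancel_right _ _ (hdet t ht).isUnit
  have hΛF : ∀ t ∈ Ici t₀, Λ t * (F t)ᵀ = S t - K t := fun t ht => by
    have h := congrArg Matrix.transpose (hFΛ t ht)
    rwa [Matrix.transpose_mul, Matrix.transpose_add, hΛsymm t ht, hSsymm t ht, hKskew t ht,
      ← sub_eq_add_neg] at h
  have hLL : ∀ t ∈ Ici t₀, L t * (L t)ᵀ = Λ t := by
    refine fun t ht => sub_eq_zero.1 (eq_zero_of_hasDerivWithinAt_mul_add_mul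
      (D := fun τ => L τ * (L τ)ᵀ - Λ τ) (F := F) (G := fun τ => (F τ)ᵀ) hF.continuousOn
      (contDiffOn_matrix_transpose hF).continuousOn (by simp [hL₀, hC]) (fun τ hτ => ?_) t ht)
    refine ((hasDerivWithinAt_matrix_mul (hL τ hτ)
      (hasDerivWithinAt_matrix_transpose (hL τ hτ))).sub (hΛ τ hτ)).congr_deriv ?_
    rw [mul_sub, sub_mul, hFΛ τ hτ, hΛF τ hτ, Matrix.transpose_mul, two_smul]
    noncomm_ring
  refine ⟨L, hL2, fun t ht => ⟨hLL t ht, ?_⟩⟩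
  rw [hderiv t ht, mul_assoc, hLL t ht, hFΛ t ht]

/-- A factor of a bounded path inherits bounds on its derivatives from those of `L' Lᵀ`. -/
theorem isLkMatrix_of_factorization {G : ℝ → Matrix (Fin m) (Fin m) ℝ} {k : ℕ} (hk : k ≤ 2)
    (hL : ContDiffOn ℝ 2 L (Ici t₀)) {μ η : ℝ} (hη : 0 < η)
    (htr : ∀ t ∈ Ici t₀, |(L t * (L t)ᵀ).trace| ≤ μ ^ 2)
    (hdet : ∀ t ∈ Ici t₀, η ^ 2 ≤ (L t * (L t)ᵀ).det)
    (hG : ∀ t ∈ Ici t₀, derivWithin L (Ici t₀) t * (L t)ᵀ = G t)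
    (hGb : ∀ i < k, NormBddOn (iteratedDerivWithin i G (Ici t₀)) (Ici t₀)) :
    IsLkMatrix t₀ k L := by
  have hdet' : ∀ t ∈ Ici t₀, η ≤ |(L t).det| := fun t ht => by
    have h := hdet t ht
    rw [Matrix.det_mul, Matrix.det_transpose, ← sq] at h
    exact (abs_of_pos hη).symm.le.trans (sq_le_sq.1 h)
  refine ⟨hL, ⟨η, hη, hdet'⟩, fun i hi => ?_⟩
  set L₁ := derivWithin L (Ici t₀)
  set L₂ := derivWithin L₁ (Ici t₀)
  have hL1 : ContDiffOn ℝ 1 L₁ (Ici t₀) := contDiffOn_derivWithin_Ici hL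
  have hb : NormBddOn L (Ici t₀) := ⟨|μ|, fun t ht => by
    have h := htr t ht
    rw [trace_mul_transpose_self_eq, abs_of_nonneg (by positivity)] at h
    exact (le_abs_self _).trans (sq_le_sq.1 h)⟩
  have hu : ∀ t ∈ Ici t₀, IsUnit (L t)ᵀ.det := fun t ht => by
    rw [Matrix.det_transpose]
    exact (abs_pos.1 (hη.trans_le (hdet' t ht))).isUnit
  have hbinv : NormBddOn (fun t => (L t)ᵀ⁻¹) (Ici t₀) :=
    hb.transpose.inv hη fun t ht => by simpa using hdet' t ht
  have hb₁ (h : 1 ≤ k) : NormBddOn L₁ (Ici t₀) := by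
    have h0 : NormBddOn G (Ici t₀) := by simpa using hGb 0 h
    refine (h0.mul hbinv).congr fun t ht => ?_
    rw [← hG t ht, Matrix.mul_nonsing_inv_cancel_right _ _ (hu t ht)]
  match i, hi with
  | 0, _ => simpa [NormBddOn] using hb
  | 1, hi => exact (hb₁ hi).congr fun t _ => congrFun iteratedDerivWithin_one t
  | 2, hi =>
    have h₁ := hb₁ (one_le_two.trans hi)
    have hG1 := hGb 1 hi
    refine ((hG1.sub (h₁.mul h₁.transpose)).mul hbinv).congr fun t ht => ?_
    have hd : HasDerivWithinAt G (L₂ t * (L t)ᵀ + L₁ t * (L₁ t)ᵀ) (Ici t₀) t :=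
      (hasDerivWithinAt_matrix_mul (hasDerivWithinAt_derivWithin_Ici hL1 one_ne_zero ht)
        (hasDerivWithinAt_matrix_transpose
          (hasDerivWithinAt_derivWithin_Ici hL two_ne_zero ht))).congr
        (fun τ hτ => (hG τ hτ).symm) (hG t ht).symm
    rw [iteratedDerivWithin_two_Ici L t, iteratedDerivWithin_one,
      hd.derivWithin (uniqueDiffOn_Ici t₀ t ht), add_sub_cancel_right,
      Matrix.mul_nonsing_inv_cancel_right _ _ (hu t ht)]
  | i + 3, hi => omega

end SymmetricEquivalence

/-- solvability of the EGS problem.  For `k ∈ {0,1,2}`, `A` of class `C¹`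
and `B` continuous, the system `ẍ + A(t)ẋ + B(t)x = 0` is `L_k`-equivalent to some system
`ξ̈ + V(t)ξ̇ + W(t)ξ = 0` with `V, W` continuous and `V(t)` symmetric iff there are a
symmetric `C¹` matrix function `S` and a symmetric positive definite `S₀` such that, with
`Λ(t) = 2∫_{t₀}^t S + S₀` and `K(t) = (Λ(t)A(t)ᵀ − A(t)Λ(t))/4`:
(1) `|tr Λ(t)| ≤ μ²` and `det Λ(t) ≥ η²` on `[t₀,∞)` for some `μ, η > 0`;
(2) if `k ≥ 1`, the derivatives of `K` and `S` of order `< k` are bounded on `[t₀,∞)`. -/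
theorem stmt_2 {m : ℕ} (t₀ : ℝ) (k : ℕ) (hk : k = 0 ∨ k = 1 ∨ k = 2)
    (A B : ℝ → Matrix (Fin m) (Fin m) ℝ)
    (hA : ContDiffOn ℝ 1 A (Ici t₀)) (hB : ContinuousOn B (Ici t₀)) :
    (∃ V W : ℝ → Matrix (Fin m) (Fin m) ℝ,
        ContinuousOn V (Ici t₀) ∧ ContinuousOn W (Ici t₀) ∧
        (∀ t ∈ Ici t₀, (V t)ᵀ = V t) ∧ LkEquiv t₀ k A B V W) ↔
      (∃ S : ℝ → Matrix (Fin m) (Fin m) ℝ, ∃ S₀ : Matrix (Fin m) (Fin m) ℝ,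
        ContDiffOn ℝ 1 S (Ici t₀) ∧ (∀ t ∈ Ici t₀, (S t)ᵀ = S t) ∧ S₀.PosDef ∧
        (∃ μ > (0:ℝ), ∃ η > (0:ℝ),
          (∀ t ∈ Ici t₀, |(Lam t₀ S S₀ t).trace| ≤ μ ^ 2) ∧
          (∀ t ∈ Ici t₀, η ^ 2 ≤ (Lam t₀ S S₀ t).det)) ∧
        (1 ≤ k → ∀ i < k,
          (∃ M : ℝ, ∀ t ∈ Ici t₀,
            ‖iteratedDerivWithin i
              (fun τ => (1/4 : ℝ) • (Lam t₀ S S₀ τ * (A τ)ᵀ - A τ * Lam t₀ S S₀ τ))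
              (Ici t₀) t‖ ≤ M) ∧
          (∃ M : ℝ, ∀ t ∈ Ici t₀, ‖iteratedDerivWithin i S (Ici t₀) t‖ ≤ M))) := by
  have hk2 : k ≤ 2 := by omega
  constructor
  · rintro ⟨V, W, -, -, hVs, L, hL, hVW⟩
    obtain ⟨S, S₀, hS, hSs, hpos, hΛ, hb⟩ := exists_symm_of_isLkMatrix (A := A) hk2 hL
      fun t ht => by rw [← (hVW t ht).1]; exact hVs t ht
    exact ⟨S, S₀, hS, hSs, hpos, hΛ, fun _ => hb⟩
  · rintro ⟨S, S₀, hS, hSs, hpos, ⟨μ, -, η, hη, htr, hdet⟩, hb⟩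
    set Λ := Lam t₀ S S₀ with hΛdef
    set K : ℝ → Matrix (Fin m) (Fin m) ℝ :=
      fun τ => (1 / 4 : ℝ) • (Λ τ * (A τ)ᵀ - A τ * Λ τ) with hKdef
    have hΛ1 : ContDiffOn ℝ 1 Λ (Ici t₀) :=
      (contDiffOn_Lam (n := 1) hS).of_le (by norm_num)
    have hK : ContDiffOn ℝ 1 K (Ici t₀) :=
      ((contDiffOn_matrix_mul hΛ1 (contDiffOn_matrix_transpose hA)).sub
        (contDiffOn_matrix_mul hA hΛ1)).const_smul (1 / 4 : ℝ)
    have hS₀ : S₀ᵀ = S₀ := by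
      simpa [Matrix.conjTranspose_eq_transpose_of_trivial] using hpos.isHermitian.eq
    have hΛs : ∀ t ∈ Ici t₀, (Λ t)ᵀ = Λ t := fun t ht =>
      transpose_Lam hS.continuousOn hSs hS₀ ht
    have hKs : ∀ t ∈ Ici t₀, (K t)ᵀ = -K t := fun t ht => by
      simp only [hKdef, Matrix.transpose_smul, Matrix.transpose_sub, Matrix.transpose_mul,
        Matrix.transpose_transpose, hΛs t ht]
      rw [← smul_neg, neg_sub]
    obtain ⟨L, hL2, hL⟩ := exists_factorization_s2 hS hK
      (fun t ht => hasDerivWithinAt_Lam hS.continuousOn ht) hΛ1 hSs hKs hΛs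
      (fun t ht => ((pow_pos hη 2).trans_le (hdet t ht)).ne')
      (by rw [Lam_self]; exact hpos.posSemidef)
    have hLk : IsLkMatrix t₀ k L := by
      refine isLkMatrix_of_factorization (G := fun t => S t + K t) hk2 hL2 hη
        (fun t ht => by rw [(hL t ht).1]; exact htr t ht)
        (fun t ht => by rw [(hL t ht).1]; exact hdet t ht) (fun t ht => (hL t ht).2)
        fun i hi => ?_
      obtain ⟨hbK, hbS⟩ := hb (by omega) i hi
      refine (NormBddOn.add hbS hbK).congr fun t ht => ?_
      have hi1 : (i : WithTop ℕ∞) ≤ 1 := by exact_mod_cast (show i ≤ 1 by omega)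
      exact iteratedDerivWithin_fun_add ht (uniqueDiffOn_Ici t₀) ((hS t ht).of_le hi1)
        ((hK t ht).of_le hi1)
    have hne : ∀ t ∈ Ici t₀, (L t).det ≠ 0 := fun t ht => by
      obtain ⟨δ, hδ, h⟩ := hLk.2.1
      exact abs_pos.1 (hδ.trans_le (h t ht))
    have hL1 := contDiffOn_derivWithin_Ici hL2
    have hinv := (contDiffOn_matrix_inv hL2 hne).continuousOn
    have hL2' := hL1.continuousOn_derivWithin (uniqueDiffOn_Ici t₀) le_rfl
    refine ⟨_, _, ?_, ?_, fun t ht => ?_, L, hLk, fun t _ => ⟨rfl, rfl⟩⟩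
    · exact continuousOn_matrix_mul hinv ((hL1.continuousOn.const_smul (2 : ℝ)).add
        (continuousOn_matrix_mul hA.continuousOn hL2.continuousOn))
    · exact continuousOn_matrix_mul hinv
        ((hL2'.add (continuousOn_matrix_mul hA.continuousOn hL1.continuousOn)).add
          (continuousOn_matrix_mul hB hL2.continuousOn))
    · refine (transpose_inv_mul_eq_iff (hne t ht)).2 ?_
      have h := congrArg Matrix.transpose (hL t ht).2
      rw [Matrix.transpose_mul, Matrix.transpose_transpose, Matrix.transpose_add, hSs t ht,
        hKs t ht] at h
      rw [(hL t ht).1, (hL t ht).2, h]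
      change K t = _
      module
end
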